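/- arXiv:2410.05832 — 2 statements merged into one kernel-verified Lean document; each statement's English description precedes it below -/
import Mathlib

section
/- Let K be a countable algebraically closed field, Γ₀ a linearly ordered commutative group with zero, and v : K → Γ₀ a surjective valuation that is nontrivial (there exists x ∈ K with v x ≠ 0 and v x ≠ 1). Define C_v(x; y, z) iff x ≠ y, x ≠ z, and v(y − z) < v(x − y), and define V_v(x, y; z, w) iff x ≠ y, z ≠ w, and v(z − w) ≤ v(x − y). Then (K, C_v, V_v) is isomorphic to M_{C,lev} = (M, C, V): there exists a bijection h : M → K such that for all a, b, c, d ∈ M, C(a; b, c) ↔ C_v(h a; h b, h c) and V(a, b; c, d) ↔ V_v(h a, h b; h c, h d). -/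
/-- The domain of `M_{C,lev}`: finitely supported functions `ℚ → ℕ`. -/
abbrev MClev : Type := ℚ →₀ ℕ

/-- For `a ≠ b`, the minimum of the (finite nonempty) set `{i : ℚ | a i ≠ b i}`,
computed in `WithTop ℚ` (it is `⊤` iff `a = b`). -/
def meet (a b : MClev) : WithTop ℚ :=
  ((a.support ∪ b.support).filter (fun i => a i ≠ b i)).min

/-- The ternary relation `C(a; b, c)` on `M_{C,lev}`. -/
def Crel (a b c : MClev) : Prop :=
  (b = c ∧ a ≠ b) ∨ (a ≠ b ∧ a ≠ c ∧ b ≠ c ∧ meet a b < meet b c)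

/-- The quaternary relation `V(a, b; c, d)` on `M_{C,lev}`. -/
def Vrel (a b c d : MClev) : Prop :=
  a ≠ b ∧ c ≠ d ∧ meet a b ≤ meet c d

/-- An automorphism of `(M, C, V)`. -/
def IsAut (g : MClev → MClev) : Prop :=
  Function.Bijective g ∧
  (∀ a b c : MClev, Crel a b c ↔ Crel (g a) (g b) (g c)) ∧
  (∀ a b c d : MClev, Vrel a b c d ↔ Vrel (g a) (g b) (g c) (g d))

/-- A partial isomorphism with domain `A`. -/
def IsPartialIso (A : Set MClev) (f : MClev → MClev) : Prop :=
  Set.InjOn f A ∧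
  (∀ a ∈ A, ∀ b ∈ A, ∀ c ∈ A, (Crel a b c ↔ Crel (f a) (f b) (f c))) ∧
  (∀ a ∈ A, ∀ b ∈ A, ∀ c ∈ A, ∀ d ∈ A,
    (Vrel a b c d ↔ Vrel (f a) (f b) (f c) (f d)))

/-- A finite set of pairs which matches the distances of the first components with those of the
second components. -/
abbrev FinIsometry {α β T : Type*} (d : α → α → T) (d' : β → β → T) : Type _ :=
  {s : Finset (α × β) // ∀ p ∈ s, ∀ q ∈ s, d p.1 q.1 = d' p.2 q.2}

/-- In a space where every triangle is isosceles with two maximal sides, the distances from a new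
point to a finite set are determined by the distance to a nearest point of the set. -/
theorem exists_dist_eq_max {α T : Type*} [LinearOrder T] {d : α → α → T}
    (symm : ∀ x y, d x y = d y x) (ultra : ∀ x y z, d x z ≤ max (d x y) (d y z))
    {A : Finset α} (hA : A.Nonempty) (a : α) :
    ∃ x ∈ A, ∀ z ∈ A, d z a = max (d x a) (d z x) := by
  obtain ⟨x, hx, hmin⟩ := A.exists_min_image (fun z => d z a) hA
  refine ⟨x, hx, fun z hz => le_antisymm ?_ (max_le (hmin z hz) ?_)⟩
  · rw [max_comm]
    exact ultra z x a
  · refine (ultra z a x).trans (max_le le_rfl ?_)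
    rw [symm a x]
    exact hmin z hz

/-- One-point extension of a finite isometry into a space with the extension property. -/
theorem exists_extension {α β T : Type*} [LinearOrder T] [Nonempty β]
    {d : α → α → T} {d' : β → β → T} (self : ∀ x y, d x x = d' y y)
    (symm : ∀ x y, d x y = d y x) (symm' : ∀ x y, d' x y = d' y x)
    (ultra : ∀ x y z, d x z ≤ max (d x y) (d y z))
    (ext' : ∀ (F : Finset β) (x : β) (t : T), ∃ y, ∀ z ∈ F, d' z y = max t (d' z x))
    (s : Finset (α × β)) (hs : ∀ p ∈ s, ∀ q ∈ s, d p.1 q.1 = d' p.2 q.2) (a : α) :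
    ∃ b, ∀ p ∈ insert (a, b) (s : Set (α × β)), ∀ q ∈ insert (a, b) (s : Set (α × β)),
      d p.1 q.1 = d' p.2 q.2 := by
  classical
  suffices h : ∃ b, ∀ p ∈ s, d p.1 a = d' p.2 b by
    obtain ⟨b, hb⟩ := h
    refine ⟨b, ?_⟩
    rintro p (rfl | hp) q (rfl | hq)
    · exact self _ _
    · rw [symm, symm']
      exact hb q hq
    · exact hb p hp
    · exact hs p hp q hq
  rcases s.eq_empty_or_nonempty with rfl | hne
  · simp
  · obtain ⟨x, hx, hd⟩ := exists_dist_eq_max symm ultra (hne.image Prod.fst) a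
    obtain ⟨p₀, hp₀, rfl⟩ := Finset.mem_image.1 hx
    obtain ⟨y, hy⟩ := ext' (s.image Prod.snd) p₀.2 (d p₀.1 a)
    refine ⟨y, fun p hp => ?_⟩
    rw [hd p.1 (Finset.mem_image_of_mem _ hp), hy p.2 (Finset.mem_image_of_mem _ hp),
      hs p hp p₀ hp₀]

/-- Back and forth: countable ultrametric spaces with the same set of distances and with the
extension property are isometric. -/
theorem exists_isometric_equiv {α β T : Type*} [LinearOrder T] [OrderBot T]
    [Countable α] [Countable β] [Nonempty α] [Nonempty β]
    {d : α → α → T} {d' : β → β → T}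
    (bot_iff : ∀ x y, d x y = ⊥ ↔ x = y) (bot_iff' : ∀ x y, d' x y = ⊥ ↔ x = y)
    (symm : ∀ x y, d x y = d y x) (symm' : ∀ x y, d' x y = d' y x)
    (ultra : ∀ x y z, d x z ≤ max (d x y) (d y z))
    (ultra' : ∀ x y z, d' x z ≤ max (d' x y) (d' y z))
    (ext : ∀ (F : Finset α) (x : α) (t : T), ∃ y, ∀ z ∈ F, d z y = max t (d z x))
    (ext' : ∀ (F : Finset β) (x : β) (t : T), ∃ y, ∀ z ∈ F, d' z y = max t (d' z x)) :
    ∃ h : α ≃ β, ∀ x y, d' (h x) (h y) = d x y := by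
  classical
  have self : ∀ x y, d x x = d' y y := fun x y =>
    ((bot_iff x x).2 rfl).trans ((bot_iff' y y).2 rfl).symm
  let toLeft : α → Order.Cofinal (FinIsometry d d') := fun a =>
    { carrier := {s | ∃ b, (a, b) ∈ s.1}
      isCofinal := by
        intro s
        obtain ⟨b, hb⟩ := exists_extension self symm symm' ultra ext' s.1 s.2 a
        exact ⟨⟨insert (a, b) s.1, by simpa using hb⟩, ⟨b, Finset.mem_insert_self _ _⟩,
          Finset.subset_insert _ _⟩ }
  let toRight : β → Order.Cofinal (FinIsometry d d') := fun b =>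
    { carrier := {s | ∃ a, (a, b) ∈ s.1}
      isCofinal := by
        intro s
        obtain ⟨a, ha⟩ := exists_extension (fun x y => (self y x).symm) symm' symm ultra' ext
          (s.1.image Prod.swap) (by
            intro p hp q hq
            obtain ⟨p, hp', rfl⟩ := Finset.mem_image.1 hp
            obtain ⟨q, hq', rfl⟩ := Finset.mem_image.1 hq
            exact (s.2 p hp' q hq').symm) b
        refine ⟨⟨insert (a, b) s.1, fun p hp q hq => ?_⟩, ⟨a, Finset.mem_insert_self _ _⟩,
          Finset.subset_insert _ _⟩
        have key : ∀ r ∈ insert (a, b) s.1,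
            r.swap ∈ insert (b, a) ((s.1.image Prod.swap : Finset (β × α)) : Set (β × α)) := by
          intro r hr
          rcases Finset.mem_insert.1 hr with rfl | hr
          · exact Or.inl rfl
          · exact Or.inr (Finset.mem_coe.2 (Finset.mem_image_of_mem _ hr))
        exact (ha p.swap (key p hp) q.swap (key q hq)).symm }
  let _ : Encodable α := Encodable.ofCountable α
  let _ : Encodable β := Encodable.ofCountable β
  let I : Order.Ideal (FinIsometry d d') :=
    Order.idealOfCofinals ⟨∅, by simp⟩ (Sum.elim toLeft toRight)
  have hleft : ∀ a, ∃ b, ∃ s ∈ I, (a, b) ∈ s.1 := fun a => by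
    obtain ⟨s, ⟨b, hb⟩, hs⟩ := Order.cofinal_meets_idealOfCofinals
      (⟨∅, by simp⟩ : FinIsometry d d') (Sum.elim toLeft toRight) (Sum.inl a)
    exact ⟨b, s, hs, hb⟩
  have hright : ∀ b, ∃ a, ∃ s ∈ I, (a, b) ∈ s.1 := fun b => by
    obtain ⟨s, ⟨a, ha⟩, hs⟩ := Order.cofinal_meets_idealOfCofinals
      (⟨∅, by simp⟩ : FinIsometry d d') (Sum.elim toLeft toRight) (Sum.inr b)
    exact ⟨a, s, hs, ha⟩
  have compat : ∀ a b a' b', (∃ s ∈ I, (a, b) ∈ s.1) → (∃ s ∈ I, (a', b') ∈ s.1) →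
      d a a' = d' b b' := by
    rintro a b a' b' ⟨s, hs, hab⟩ ⟨s', hs', hab'⟩
    obtain ⟨m, -, hm, hm'⟩ := I.directed s hs s' hs'
    exact m.2 (a, b) (hm hab) (a', b') (hm' hab')
  choose f hf using hleft
  choose g hg using hright
  exact ⟨⟨f, g,
    fun a => (bot_iff _ _).1 ((compat _ _ _ _ (hg (f a)) (hf a)).trans ((bot_iff' _ _).2 rfl)),
    fun b => (bot_iff' _ _).1 ((compat _ _ _ _ (hf (g b)) (hg b)).symm.trans
      ((bot_iff _ _).2 rfl))⟩,
    fun x y => (compat _ _ _ _ (hf x) (hf y)).symm⟩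

theorem le_meet_iff (a b : MClev) (c : WithTop ℚ) :
    c ≤ meet a b ↔ ∀ i : ℚ, (i : WithTop ℚ) < c → a i = b i := by
  unfold meet
  rw [Finset.le_min_iff]
  constructor
  · intro h i hi
    by_contra hne
    refine absurd (h i (Finset.mem_filter.2 ⟨?_, hne⟩)) (not_le.2 hi)
    simp only [Finset.mem_union, Finsupp.mem_support_iff]
    by_contra! h0
    exact hne (h0.1.trans h0.2.symm)
  · intro h i hi
    by_contra! hlt
    exact (Finset.mem_filter.1 hi).2 (h i hlt)

theorem meet_eq_top_iff (a b : MClev) : meet a b = ⊤ ↔ a = b := by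
  rw [← top_le_iff, le_meet_iff]
  exact ⟨fun h => Finsupp.ext fun i => h i (WithTop.coe_lt_top i), fun h i _ => h ▸ rfl⟩

theorem meet_comm (a b : MClev) : meet a b = meet b a :=
  eq_of_forall_le_iff fun c => by simp only [le_meet_iff, eq_comm]

theorem min_meet_le (a b c : MClev) : min (meet a b) (meet b c) ≤ meet a c := by
  rw [le_meet_iff]
  intro i hi
  obtain ⟨h₁, h₂⟩ := lt_min_iff.1 hi
  exact ((le_meet_iff a b _).1 le_rfl i h₁).trans ((le_meet_iff b c _).1 le_rfl i h₂)

theorem exists_meet_eq_min (F : Finset MClev) (x : MClev) (t : WithTop ℚ) :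
    ∃ y, ∀ z ∈ F, meet z y = min t (meet z x) := by
  induction t using WithTop.recTopCoe with
  | top => exact ⟨x, fun z _ => (min_eq_right le_top).symm⟩
  | coe q =>
    obtain ⟨n, hn⟩ := Infinite.exists_notMem_finset (F.image fun z => z q)
    refine ⟨x.update q n, fun z hz => eq_of_forall_le_iff fun c => ?_⟩
    have hzn : z q ≠ n := fun h => hn (Finset.mem_image.2 ⟨z, hz, h⟩)
    rw [le_min_iff, le_meet_iff, le_meet_iff]
    have upd : ∀ i, i ≠ q → x.update q n i = x i := fun i hi => by
      simp [Finsupp.update_apply, hi]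
    constructor
    · intro h
      have hc : c ≤ q := by
        by_contra! hlt
        exact hzn (by simpa using h q hlt)
      refine ⟨hc, fun i hi => ?_⟩
      rw [h i hi, upd i (WithTop.coe_lt_coe.1 (hi.trans_le hc)).ne]
    · rintro ⟨hc, h⟩ i hi
      rw [h i hi, upd i (WithTop.coe_lt_coe.1 (hi.trans_le hc)).ne]

section Valuation

variable {K Γ₀ : Type*} [Field K] [IsAlgClosed K] [LinearOrderedCommGroupWithZero Γ₀]
  (v : Valuation K Γ₀)

/-- The residue field of an algebraically closed valued field is infinite, in elementary terms. -/
theorem exists_integer_sub_eq_one (W : Finset K) (hW : ∀ w ∈ W, v w ≤ 1) :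
    ∃ u, v u ≤ 1 ∧ ∀ w ∈ W, v (u - w) = 1 := by
  classical
  let W' := insert 0 W
  have hW' : ∀ w ∈ W', v w ≤ 1 := by simpa [W'] using hW
  let P : Polynomial K := ∏ w ∈ W', (Polynomial.X - Polynomial.C w)
  have hdeg : 0 < P.degree := by
    rw [Polynomial.degree_prod]
    simp [W']
  obtain ⟨u, hu⟩ : ∃ u, P.eval u = 1 := by
    obtain ⟨u, hu⟩ := IsAlgClosed.exists_root (P - Polynomial.C 1) (by
      rw [Polynomial.degree_sub_C hdeg]
      exact hdeg.ne')
    exact ⟨u, by simpa [sub_eq_zero] using hu⟩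
  have hprod : ∏ w ∈ W', v (u - w) = 1 := by
    rw [← map_prod, ← map_one v, ← hu]
    simp [P, Polynomial.eval_prod]
  have hu1 : v u ≤ 1 := by
    by_contra! hlt
    have h : ∏ w ∈ W', v (u - w) = v u ^ W'.card :=
      Finset.prod_eq_pow_card fun w hw =>
        Valuation.map_sub_eq_of_lt_left v ((hW' w hw).trans_lt hlt)
    rw [hprod] at h
    exact (one_lt_pow₀ hlt (by simp [W'])).ne h
  refine ⟨u, hu1, fun w hw => ?_⟩
  have hle : ∀ w ∈ W', v (u - w) ≤ 1 := fun w hw => v.map_sub_le hu1 (hW' w hw)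
  have hmem : w ∈ W' := Finset.mem_insert_of_mem hw
  refine le_antisymm (hle w hmem) ?_
  rw [← hprod, ← Finset.mul_prod_erase _ _ hmem]
  exact mul_le_of_le_one_right' (Finset.prod_le_one' fun i hi => hle i (Finset.mem_of_mem_erase hi))

theorem exists_valuation_sub_eq_max (hsurj : Function.Surjective v) (F : Finset K) (x : K)
    (t : Γ₀) : ∃ y, ∀ z ∈ F, v (z - y) = max t (v (z - x)) := by
  classical
  obtain ⟨c, rfl⟩ := hsurj t
  rcases eq_or_ne c 0 with rfl | hc
  · exact ⟨x, fun z _ => by simp⟩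
  obtain ⟨u, hu, hW⟩ := exists_integer_sub_eq_one v
    ((F.image fun z => (z - x) / c).filter fun w => v w ≤ 1) (by simp)
  refine ⟨x + c * u, fun z hz => ?_⟩
  have hz' : z - (x + c * u) = c * ((z - x) / c - u) := by field_simp; ring
  have hzx : z - x = c * ((z - x) / c) := by field_simp
  have key : v ((z - x) / c - u) = max 1 (v ((z - x) / c)) := by
    rcases le_or_gt (v ((z - x) / c)) 1 with h | h
    · rw [max_eq_left h, Valuation.map_sub_swap]
      exact hW _ (Finset.mem_filter.2 ⟨Finset.mem_image_of_mem _ hz, h⟩)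
    · rw [max_eq_right h.le]
      exact Valuation.map_sub_eq_of_lt_left v (hu.trans_lt h)
  have hmono : Monotone fun s => v c * s := fun _ _ h => mul_le_mul_right h _
  rw [hz', map_mul, key, hmono.map_max, mul_one, ← map_mul, ← hzx]

theorem denselyOrdered_units (hsurj : Function.Surjective v) : DenselyOrdered Γ₀ˣ := by
  refine ⟨fun a b hab => ?_⟩
  obtain ⟨x, hx⟩ := hsurj (a * b : Γ₀ˣ)
  obtain ⟨z, hz⟩ := IsAlgClosed.exists_pow_nat_eq x (n := 2) two_pos
  have hvz : v z ^ 2 = (a * b : Γ₀ˣ) := by rw [← map_pow, hz, hx]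
  have hz0 : v z ≠ 0 := fun h => by
    rw [h] at hvz
    exact (a * b).ne_zero (by simpa using hvz.symm)
  have hc : (Units.mk0 _ hz0) ^ 2 = a * b := Units.ext (by simpa using hvz)
  refine ⟨Units.mk0 _ hz0, ?_, ?_⟩
  · by_contra! h
    exact (mul_lt_mul_of_le_of_lt h (h.trans_lt hab)).ne (by rw [← pow_two, hc])
  · by_contra! h
    exact (mul_lt_mul_of_lt_of_le (hab.trans_le h) h).ne (by rw [← pow_two, hc])

theorem exists_strictAnti_surjective [Countable K] (hsurj : Function.Surjective v)
    (hnontriv : ∃ x : K, v x ≠ 0 ∧ v x ≠ 1) :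
    ∃ E : WithTop ℚ → Γ₀, StrictAnti E ∧ Function.Surjective E ∧ E ⊤ = 0 := by
  have := denselyOrdered_units v hsurj
  have : Countable Γ₀ := hsurj.countable
  have : Countable Γ₀ˣ := Units.val_injective.countable
  have : Countable Γ₀ˣᵒᵈ := inferInstanceAs (Countable Γ₀ˣ)
  have : Nontrivial Γ₀ˣ := by
    obtain ⟨x, h0, h1⟩ := hnontriv
    exact ⟨Units.mk0 _ h0, 1, fun h => h1 (by simpa using congrArg Units.val h)⟩
  obtain ⟨e⟩ := Order.iso_of_countable_dense ℚ Γ₀ˣᵒᵈ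
  let E : WithTop ℚ → Γ₀ := WithTop.recTopCoe 0 fun q => ((OrderDual.ofDual (e q) : Γ₀ˣ) : Γ₀)
  refine ⟨E, ?_, ?_, rfl⟩
  · intro a b hab
    induction a using WithTop.recTopCoe with
    | top => exact absurd hab not_top_lt
    | coe a =>
      induction b using WithTop.recTopCoe with
      | top => exact Units.zero_lt _
      | coe b => exact Units.val_lt_val.2 (e.strictMono (WithTop.coe_lt_coe.1 hab))
  · intro t
    rcases eq_or_ne t 0 with rfl | ht
    · exact ⟨⊤, rfl⟩
    · refine ⟨(e.symm (OrderDual.toDual (Units.mk0 t ht)) : ℚ), ?_⟩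
      change ((OrderDual.ofDual (e (e.symm _)) : Γ₀ˣ) : Γ₀) = t
      rw [e.apply_symm_apply]
      rfl

end Valuation

/-- if `K` is a countable algebraically closed field with a
surjective nontrivial valuation `v`, then `(K, C_v, V_v)` is isomorphic to
`M_{C,lev} = (M, C, V)`. -/
theorem MClev_definable_in_ACVF (K : Type*) [Field K] [IsAlgClosed K] [Countable K]
    (Γ₀ : Type*) [LinearOrderedCommGroupWithZero Γ₀] (v : Valuation K Γ₀)
    (hsurj : Function.Surjective v)
    (hnontriv : ∃ x : K, v x ≠ 0 ∧ v x ≠ 1) :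
    ∃ h : MClev ≃ K,
      (∀ a b c : MClev, Crel a b c ↔
        (h a ≠ h b ∧ h a ≠ h c ∧ v (h b - h c) < v (h a - h b))) ∧
      (∀ a b c d : MClev, Vrel a b c d ↔
        (h a ≠ h b ∧ h c ≠ h d ∧ v (h c - h d) ≤ v (h a - h b))) := by
  obtain ⟨E, hE, hEsurj, hEtop⟩ := exists_strictAnti_surjective v hsurj hnontriv
  obtain ⟨h, hh⟩ := exists_isometric_equiv (d := fun a b : MClev => E (meet a b))
    (d' := fun x y : K => v (x - y))
    (fun a b => by rw [← meet_eq_top_iff, ← hE.injective.eq_iff, hEtop, bot_eq_zero])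
    (fun x y => by rw [bot_eq_zero, map_eq_zero, sub_eq_zero])
    (fun a b => by rw [meet_comm])
    (fun x y => v.map_sub_swap x y)
    (fun a b c => by
      rw [← hE.antitone.map_min]
      exact hE.antitone (min_meet_le a b c))
    (fun x y z => by simpa using v.map_add (x - y) (y - z))
    (fun F x t => by
      obtain ⟨q, rfl⟩ := hEsurj t
      obtain ⟨y, hy⟩ := exists_meet_eq_min F x q
      exact ⟨y, fun z hz => by rw [hy z hz, hE.antitone.map_min]⟩)
    (exists_valuation_sub_eq_max v hsurj)
  refine ⟨h, fun a b c => ?_, fun a b c d => ?_⟩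
  · rw [hh, hh, hE.lt_iff_gt, h.injective.ne_iff, h.injective.ne_iff, Crel]
    constructor
    · rintro (⟨rfl, hab⟩ | ⟨hab, hac, -, hlt⟩)
      · refine ⟨hab, hab, ?_⟩
        rw [(meet_eq_top_iff b b).2 rfl, lt_top_iff_ne_top, ne_eq, meet_eq_top_iff]
        exact hab
      · exact ⟨hab, hac, hlt⟩
    · rintro ⟨hab, hac, hlt⟩
      by_cases hbc : b = c
      · exact Or.inl ⟨hbc, hab⟩
      · exact Or.inr ⟨hab, hac, hbc, hlt⟩
  · rw [hh, hh, hE.le_iff_ge, h.injective.ne_iff, h.injective.ne_iff, Vrel]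
end

section
/- The age of M_{C,lev} is not well-quasi-ordered under embeddability: there exists a sequence (Aₙ)_{n ∈ ℕ} of finite subsets of M such that for all m ≠ n there is no partial isomorphism from A_m into A_n (no injective map A_m → A_n preserving C and V and their negations). -/
lemma meet_eq_coe {a b : MClev} {i : ℚ} (hi : a i ≠ b i) (hlt : ∀ k < i, a k = b k) :
    meet a b = (i : WithTop ℚ) := by
  unfold meet
  apply le_antisymm
  · apply Finset.min_le
    simp only [Finset.mem_filter, Finset.mem_union, Finsupp.mem_support_iff]
    refine ⟨?_, hi⟩
    by_contra! h
    exact hi (h.1.trans h.2.symm)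
  · apply Finset.le_min
    intro k hk
    rw [WithTop.coe_le_coe]
    by_contra! h
    exact (Finset.mem_filter.1 hk).2 (hlt k h)

lemma meet_self (a : MClev) : meet a a = ⊤ := by
  simp [meet]

/-- The lower endpoint of the `j`-th edge of the cycle on the vertices `1, …, N`. -/
def edgeLo (N j : ℕ) : ℕ := if j + 1 < N then j + 1 else 1

/-- The upper endpoint of the `j`-th edge of the cycle on the vertices `1, …, N`. -/
def edgeHi (N j : ℕ) : ℕ := if j + 1 < N then j + 2 else N

lemma edgeLo_pos (N j : ℕ) : 0 < edgeLo N j := by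
  unfold edgeLo; split_ifs <;> omega

lemma edgeLo_lt_edgeHi {N : ℕ} (hN : 2 ≤ N) (j : ℕ) : edgeLo N j < edgeHi N j := by
  unfold edgeLo edgeHi; split_ifs <;> omega

/-- The three points coding the `j`-th edge: the points `0` and `2` branch at the upper endpoint
of the edge, and the point `1` branches off both of them at the lower endpoint. -/
noncomputable def edgePoint (N : ℕ) (x : ℕ × Fin 3) : MClev :=
  Finsupp.single 0 x.1 +
    if x.2 = 0 then 0
    else if x.2 = 1 then Finsupp.single (edgeLo N x.1 : ℚ) 1
    else Finsupp.single (edgeHi N x.1 : ℚ) 1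

/-- The level at which two distinct points of the form `edgePoint N x` branch. -/
def edgeLevel (N : ℕ) (x y : ℕ × Fin 3) : ℕ :=
  if x.1 = y.1 then (if x.2 = 1 ∨ y.2 = 1 then edgeLo N x.1 else edgeHi N x.1) else 0

lemma edgePoint_apply_zero {N : ℕ} (hN : 2 ≤ N) (x : ℕ × Fin 3) : edgePoint N x 0 = x.1 := by
  have h1 : (edgeLo N x.1 : ℚ) ≠ 0 := by exact_mod_cast (edgeLo_pos N x.1).ne'
  have h2 : (edgeHi N x.1 : ℚ) ≠ 0 := by
    exact_mod_cast (edgeLo_pos N x.1 |>.trans (edgeLo_lt_edgeHi hN x.1)).ne'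
  unfold edgePoint
  split_ifs <;> simp [h1, h2]

lemma edgePoint_apply_neg (N : ℕ) (x : ℕ × Fin 3) {k : ℚ} (hk : k < 0) : edgePoint N x k = 0 := by
  have h1 : (edgeLo N x.1 : ℚ) ≠ k := (hk.trans_le (Nat.cast_nonneg _)).ne'
  have h2 : (edgeHi N x.1 : ℚ) ≠ k := (hk.trans_le (Nat.cast_nonneg _)).ne'
  unfold edgePoint
  split_ifs <;> simp [h1, h2, hk.ne']

lemma meet_edgePoint {N : ℕ} (hN : 2 ≤ N) {x y : ℕ × Fin 3} (hxy : x ≠ y) :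
    meet (edgePoint N x) (edgePoint N y) = ((edgeLevel N x y : ℚ) : WithTop ℚ) := by
  by_cases h : x.1 = y.1
  · obtain ⟨i, s⟩ := x
    obtain ⟨j, t⟩ := y
    obtain rfl : i = j := h
    have hlt : (edgeLo N i : ℚ) < edgeHi N i := by exact_mod_cast edgeLo_lt_edgeHi hN i
    have hst : s ≠ t := fun e => hxy (by rw [e])
    apply meet_eq_coe
    · fin_cases s <;> fin_cases t <;>
        simp [edgePoint, edgeLevel, hlt.ne] at hst ⊢
    · intro k hk
      have hk' : k < edgeHi N i := by
        refine hk.trans_le ?_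
        simp only [edgeLevel, if_true]
        split_ifs
        exacts [hlt.le, le_rfl]
      fin_cases s <;> fin_cases t <;>
        simp [edgePoint, edgeLevel] at hst hk ⊢ <;>
        simp [hk.ne', hk'.ne']
  · apply meet_eq_coe
    · simp [edgeLevel, h, edgePoint_apply_zero hN]
    · intro k hk
      have hk : k < 0 := by simpa [edgeLevel, h] using hk
      rw [edgePoint_apply_neg N x hk, edgePoint_apply_neg N y hk]

lemma edgePoint_injective {N : ℕ} (hN : 2 ≤ N) : Function.Injective (edgePoint N) := by
  intro x y h
  by_contra hxy
  have := meet_edgePoint hN hxy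
  rw [h, meet_self] at this
  exact WithTop.top_ne_coe this

lemma vrel_edgePoint {N : ℕ} (hN : 2 ≤ N) {x y z w : ℕ × Fin 3} (hxy : x ≠ y) (hzw : z ≠ w) :
    Vrel (edgePoint N x) (edgePoint N y) (edgePoint N z) (edgePoint N w) ↔
      edgeLevel N x y ≤ edgeLevel N z w := by
  have h := edgePoint_injective hN
  simp [Vrel, h.ne hxy, h.ne hzw, meet_edgePoint hN hxy, meet_edgePoint hN hzw]

/-- An order-preserving injection between the cycles on `1, …, M` and `1, …, N` which maps edges
to edges, given by the images `a j < b j` of the endpoints of the edges, forces `M = N`. -/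
lemma eq_of_edge_map {M N : ℕ} (hM : 3 ≤ M) {a b : ℕ → ℕ}
    (hlt : ∀ j < M, a j < b j)
    (hedge : ∀ j < M, ∃ c < N, a j = edgeLo N c ∧ b j = edgeHi N c)
    (hsucc : ∀ j, j + 2 < M → b j = a (j + 1))
    (ha : a (M - 1) = a 0) (hb : b (M - 1) = b (M - 2)) : M = N := by
  have hcase : ∀ j < M, 1 ≤ a j ∧ b j ≤ N ∧ (b j = a j + 1 ∨ (a j = 1 ∧ b j = N)) := by
    intro j hj
    obtain ⟨c, hc, h1, h2⟩ := hedge j hj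
    have := hlt j hj
    unfold edgeLo at h1
    unfold edgeHi at h2
    split_ifs at h1 h2 <;> omega
  have hstep : ∀ j, j + 1 < M → b j = a j + 1 := by
    intro j hj
    obtain ⟨h1, h2, h3 | ⟨h3, h4⟩⟩ := hcase j (by omega)
    · exact h3
    · rcases j with _ | j
      · have := hsucc 0 (by omega)
        have := hlt 1 (by omega)
        have := hcase 1 (by omega)
        simp only [zero_add] at *
        omega
      · have := hsucc j (by omega)
        have := hlt j (by omega)
        have := hcase j (by omega)
        omega
  have hshift : ∀ j, j + 1 < M → a j = a 0 + j := by
    intro j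
    induction j with
    | zero => simp
    | succ j ih =>
      intro hj
      have := ih (by omega)
      have := hstep j (by omega)
      have := hsucc j (by omega)
      omega
  have := hshift (M - 2) (by omega)
  have := hstep (M - 2) (by omega)
  have := hcase (M - 1) (by omega)
  omega

lemma edge_of_edgeLevel_lt {N : ℕ} {x y z : ℕ × Fin 3}
    (hN : 2 ≤ N) (hpos : 0 < edgeLevel N y x) (hlt : edgeLevel N y x < edgeLevel N x z) :
    edgeLevel N y x = edgeLo N x.1 ∧ edgeLevel N x z = edgeHi N x.1 := by
  have := edgeLo_lt_edgeHi hN x.1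
  unfold edgeLevel at *
  split_ifs at * <;> (simp_all; try omega)

lemma eq_of_edgeLevel_le_iff {M N : ℕ} (hM : 3 ≤ M) (hN : 2 ≤ N) {g : ℕ × Fin 3 → ℕ × Fin 3}
    (hg : ∀ x, x.1 < M → (g x).1 < N)
    (h : ∀ x y z w : ℕ × Fin 3, x.1 < M → y.1 < M → z.1 < M → w.1 < M → x ≠ y → z ≠ w →
      (edgeLevel M x y ≤ edgeLevel M z w ↔
        edgeLevel N (g x) (g y) ≤ edgeLevel N (g z) (g w))) : M = N := by
  have hlo : ∀ j, edgeLevel M (j, 1) (j, 0) = edgeLo M j := by simp [edgeLevel]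
  have hhi : ∀ j, edgeLevel M (j, 0) (j, 2) = edgeHi M j := by simp [edgeLevel]
  have heq : ∀ x y z w : ℕ × Fin 3, x.1 < M → y.1 < M → z.1 < M → w.1 < M → x ≠ y → z ≠ w →
      edgeLevel M x y = edgeLevel M z w →
        edgeLevel N (g x) (g y) = edgeLevel N (g z) (g w) :=
    fun x y z w hx hy hz hw hxy hzw e =>
      le_antisymm ((h x y z w hx hy hz hw hxy hzw).1 e.le)
        ((h z w x y hz hw hx hy hzw hxy).1 e.ge)
  have hlt : ∀ j < M, edgeLevel N (g (j, 1)) (g (j, 0)) < edgeLevel N (g (j, 0)) (g (j, 2)) := by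
    intro j hj
    rw [← not_le, ← h _ _ _ _ hj hj hj hj (by simp) (by simp), not_le, hlo, hhi]
    exact edgeLo_lt_edgeHi (by omega) j
  have hpos : ∀ j < M, 0 < edgeLevel N (g (j, 1)) (g (j, 0)) := by
    intro j hj
    refine (Nat.zero_le (edgeLevel N (g (0, 0)) (g (1, 0)))).trans_lt ?_
    rw [← not_le, ← h _ _ _ _ hj hj (by simp; omega) (by simp; omega) (by simp) (by simp),
      not_le, hlo]
    simpa [edgeLevel] using edgeLo_pos M j
  refine eq_of_edge_map (N := N) hM
    (a := fun j => edgeLevel N (g (j, 1)) (g (j, 0)))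
    (b := fun j => edgeLevel N (g (j, 0)) (g (j, 2))) hlt ?_ ?_ ?_ ?_
  · exact fun j hj => ⟨(g (j, 0)).1, hg _ hj, edge_of_edgeLevel_lt hN (hpos j hj) (hlt j hj)⟩
  · intro j hj
    refine heq _ _ _ _ ?_ ?_ ?_ ?_ (by simp) (by simp) ?_ <;> try (dsimp only; omega)
    rw [hlo, hhi]; unfold edgeLo edgeHi; split_ifs <;> omega
  · refine heq _ _ _ _ ?_ ?_ ?_ ?_ (by simp) (by simp) ?_ <;> try (dsimp only; omega)
    rw [hlo, hlo]; unfold edgeLo; split_ifs <;> omega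
  · refine heq _ _ _ _ ?_ ?_ ?_ ?_ (by simp) (by simp) ?_ <;> try (dsimp only; omega)
    rw [hhi, hhi]; unfold edgeHi; split_ifs <;> omega

/-- the age of `M_{C,lev}` is not well-quasi-ordered under
embeddability: there is an infinite antichain, i.e. a sequence `(Aₙ)` of
finite subsets of `M` such that for `m ≠ n` there is no partial isomorphism
from `A_m` into `A_n`. -/
theorem age_not_wqo :
    ∃ A : ℕ → Finset MClev, ∀ m n : ℕ, m ≠ n →
      ¬ ∃ f : MClev → MClev,
          IsPartialIso (A m : Set MClev) f ∧
          f '' (A m : Set MClev) ⊆ (A n : Set MClev) := by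
  refine ⟨fun n => (Finset.range (n + 3) ×ˢ Finset.univ).image (edgePoint (n + 3)), ?_⟩
  rintro m n hmn ⟨f, ⟨hinj, -, hV⟩, himg⟩
  have hM : 2 ≤ m + 3 := by omega
  have hN : 2 ≤ n + 3 := by omega
  have hmem : ∀ x : ℕ × Fin 3, x.1 < m + 3 → edgePoint (m + 3) x ∈
      (((Finset.range (m + 3) ×ˢ Finset.univ).image (edgePoint (m + 3)) : Finset MClev) :
        Set MClev) := by
    intro x hx
    rw [Finset.mem_coe]
    exact Finset.mem_image_of_mem _ (by simpa using hx)
  have hex : ∀ x : ℕ × Fin 3, ∃ y : ℕ × Fin 3, x.1 < m + 3 →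
      y.1 < n + 3 ∧ edgePoint (n + 3) y = f (edgePoint (m + 3) x) := by
    intro x
    by_cases hx : x.1 < m + 3
    · obtain ⟨y, hy, hyx⟩ := Finset.mem_image.1
        (Finset.mem_coe.1 (himg (Set.mem_image_of_mem f (hmem x hx))))
      exact ⟨y, fun _ => ⟨by simpa using hy, hyx⟩⟩
    · exact ⟨x, fun h => absurd h hx⟩
  choose g hg using hex
  have hgne : ∀ x y : ℕ × Fin 3, x.1 < m + 3 → y.1 < m + 3 → x ≠ y → g x ≠ g y := by
    intro x y hx hy hxy e
    apply hxy
    apply edgePoint_injective hM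
    apply hinj (hmem x hx) (hmem y hy)
    rw [← (hg x hx).2, ← (hg y hy).2, e]
  have := eq_of_edgeLevel_le_iff (M := m + 3) (N := n + 3) (g := g) (by omega) hN
    (fun x hx => (hg x hx).1) (by
      intro x y z w hx hy hz hw hxy hzw
      rw [← vrel_edgePoint hM hxy hzw,
        ← vrel_edgePoint hN (hgne x y hx hy hxy) (hgne z w hz hw hzw),
        (hg x hx).2, (hg y hy).2, (hg z hz).2, (hg w hw).2]
      exact hV _ (hmem x hx) _ (hmem y hy) _ (hmem z hz) _ (hmem w hw))
  omega
end
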